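/- arXiv:2312.04611 — 4 statements merged into one kernel-verified Lean document; each statement's English description precedes it below -/
import Mathlib

section
/- (Deterministic 2-3 method.) Let a : {1,2,3,...} → ℝ satisfy 0 < a(l) ≤ 1 for all l. Suppose (i) there is a constant c > 0 such that a(l+1) ≥ c·a(l) for all l ≥ 1, and (ii) there is l₀ such that for all l ≥ l₀, a(l)² ≤ l²·a(2l) and a(l)³ ≤ l²·a(3l). Then the limit lim_{l→∞} a(l)^{1/l} exists and is strictly positive. -/
open MeasureTheory Filter Topology
open scoped Classical ENNReal

noncomputable section

namespace GrowthURT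

/-- If `u = q * B - p * A` is a positive step, the set `ℕ A + ℕ B` is eventually `u`-dense. -/
lemma eventually_exists_add_mul_near {A B u : ℝ} (hA : 0 < A) (hu : 0 < u) (p q : ℕ)
    (h : u = q * B - p * A) :
    ∀ᶠ y : ℝ in atTop, ∃ i j : ℕ, i * A + j * B ≤ y ∧ y < i * A + j * B + u := by
  filter_upwards [eventually_ge_atTop ((A / u) * p * A + A), eventually_ge_atTop 0] with y hy hy0
  set i := ⌊y / A⌋₊
  have hi1 : i * A ≤ y := by
    have := Nat.floor_le (div_nonneg hy0 hA.le)
    rwa [le_div_iff₀ hA] at this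
  have hi2 : y < (i + 1) * A := by
    have := Nat.lt_floor_add_one (y / A)
    rwa [div_lt_iff₀ hA] at this
  set j := ⌊(y - i * A) / u⌋₊
  have hj1 : j * u ≤ y - i * A := by
    have := Nat.floor_le (div_nonneg (sub_nonneg.2 hi1) hu.le)
    rwa [le_div_iff₀ hu] at this
  have hj2 : y - i * A < (j + 1) * u := by
    have := Nat.lt_floor_add_one ((y - i * A) / u)
    rwa [div_lt_iff₀ hu] at this
  have hjA : (j : ℝ) ≤ A / u := by
    rw [le_div_iff₀ hu]; linarith
  have hle : j * p ≤ i := by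
    have h1 : (j : ℝ) * p * A ≤ A / u * p * A := by gcongr
    have h2 : (j : ℝ) * p * A ≤ i * A := by linarith
    exact_mod_cast le_of_mul_le_mul_right h2 hA
  refine ⟨i - j * p, j * q, ?_, ?_⟩
  all_goals
    push_cast [Nat.cast_sub hle]
    have : ((i : ℝ) - j * p) * A + j * q * B = i * A + j * u := by rw [h]; ring
    rw [this]; linarith

lemma irrational_log_two_div_log_three : Irrational (Real.log 2 / Real.log 3) := by
  rintro ⟨r, hr⟩
  have h2 : 0 < Real.log 2 := Real.log_pos (by norm_num)
  have h3 : 0 < Real.log 3 := Real.log_pos (by norm_num)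
  have hr0 : 0 < r := by
    have : (0 : ℝ) < r := by rw [hr]; positivity
    exact_mod_cast this
  have hden : (0 : ℝ) < r.den := by exact_mod_cast r.pos
  have hnum : ((r.num.toNat : ℕ) : ℝ) = r.num := by
    exact_mod_cast Int.toNat_of_nonneg (Rat.num_pos.2 hr0).le
  have key : (r.den : ℝ) * Real.log 2 = r.num.toNat * Real.log 3 := by
    rw [Rat.cast_def] at hr
    rw [hnum]
    field_simp at hr
    linarith
  rw [← Real.log_pow, ← Real.log_pow] at key
  have hpow : 2 ^ r.den = 3 ^ r.num.toNat := by
    exact_mod_cast Real.log_injOn_pos (Set.mem_Ioi.2 (by positivity))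
      (Set.mem_Ioi.2 (by positivity)) key
  have heven : Even (3 ^ r.num.toNat) := hpow ▸ (even_two.pow_of_ne_zero r.den_nz)
  exact (Nat.not_even_iff_odd.2 (Odd.pow (by decide))) heven

/-- Consecutive elements of `ℕ log 2 + ℕ log 3` get arbitrarily close. -/
lemma eventually_exists_log_two_log_three_near {δ : ℝ} (hδ : 0 < δ) :
    ∀ᶠ y : ℝ in atTop, ∃ i j : ℕ,
      i * Real.log 2 + j * Real.log 3 ≤ y ∧ y < i * Real.log 2 + j * Real.log 3 + δ := by
  have h2 : 0 < Real.log 2 := Real.log_pos (by norm_num)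
  have h3 : Real.log 2 < Real.log 3 := Real.log_lt_log (by norm_num) (by norm_num)
  have hd := dense_addSubgroupClosure_pair_iff.2 irrational_log_two_div_log_three
  obtain ⟨u, hu, hmem⟩ := hd.exists_mem_open isOpen_Ioo
    (Set.nonempty_Ioo.2 (lt_min hδ h2))
  obtain ⟨x, y, rfl⟩ := AddSubgroup.mem_closure_pair.1 hu
  obtain ⟨hu0, hu1⟩ := hmem
  have huδ := hu1.trans_le (min_le_left _ _)
  have hu2 := hu1.trans_le (min_le_right _ _)
  simp only [zsmul_eq_mul] at *
  rcases le_or_gt x 0 with hx | hx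
  · have hy : 0 ≤ y := by
      by_contra! hy
      have hx' : (x : ℝ) ≤ 0 := by exact_mod_cast hx
      have hy' : (y : ℝ) ≤ 0 := by exact_mod_cast hy.le
      nlinarith
    lift y to ℕ using hy
    obtain ⟨x, rfl⟩ : ∃ p : ℕ, x = -p := ⟨x.natAbs, by omega⟩
    filter_upwards [eventually_exists_add_mul_near (B := Real.log 3) h2 hu0 x y
      (by push_cast; ring)] with z ⟨i, j, h, h'⟩
    exact ⟨i, j, h, by linarith⟩
  · have hy : y ≤ 0 := by
      by_contra! hy
      have hx' : (1 : ℝ) ≤ x := by exact_mod_cast hx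
      have hy' : (0 : ℝ) ≤ y := by exact_mod_cast hy.le
      nlinarith
    lift x to ℕ using hx.le
    obtain ⟨y, rfl⟩ : ∃ p : ℕ, y = -p := ⟨y.natAbs, by omega⟩
    filter_upwards [eventually_exists_add_mul_near (B := Real.log 2) (h2.trans h3) hu0 y x
      (by push_cast; ring)] with z ⟨i, j, h, h'⟩
    exact ⟨j, i, by linarith, by linarith⟩

/-- Consecutive integers of the form `2 ^ i * 3 ^ j` have ratio tending to `1`. -/
lemma eventually_exists_two_pow_mul_three_pow_near {ε : ℝ} (hε : 0 < ε) :
    ∀ᶠ x : ℝ in atTop, ∃ i j : ℕ,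
      (2 : ℝ) ^ i * 3 ^ j ≤ x ∧ x < (1 + ε) * (2 ^ i * 3 ^ j) := by
  have h := Real.tendsto_log_atTop.eventually
    (eventually_exists_log_two_log_three_near (Real.log_pos (by linarith : 1 < 1 + ε)))
  filter_upwards [h, eventually_gt_atTop 0] with x ⟨i, j, h1, h2⟩ hx
  have hlog : (i : ℝ) * Real.log 2 + j * Real.log 3 = Real.log (2 ^ i * 3 ^ j) := by
    rw [Real.log_mul (by positivity) (by positivity), Real.log_pow, Real.log_pow]
  rw [hlog] at h1 h2
  rw [← Real.log_mul (by positivity) (by positivity), mul_comm] at h2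
  exact ⟨i, j, (Real.log_le_log_iff (by positivity) hx).1 h1,
    (Real.log_lt_log_iff hx (by positivity)).1 h2⟩

lemma le_two_pow_mul_three_pow_mul {F : ℕ → ℝ} {l₀ : ℕ}
    (h2 : ∀ l, l₀ ≤ l → F (2 * l) ≤ 2 * F l) (h3 : ∀ l, l₀ ≤ l → F (3 * l) ≤ 3 * F l)
    {l : ℕ} (hl : l₀ ≤ l) (i j : ℕ) :
    F (2 ^ i * 3 ^ j * l) ≤ 2 ^ i * 3 ^ j * F l := by
  induction i with
  | zero =>
    induction j with
    | zero => simp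
    | succ j ih =>
      have := h3 (2 ^ 0 * 3 ^ j * l) (hl.trans (Nat.le_mul_of_pos_left _ (by positivity)))
      rw [show 2 ^ 0 * 3 ^ (j + 1) * l = 3 * (2 ^ 0 * 3 ^ j * l) by ring]
      calc _ ≤ _ := this
        _ ≤ 3 * (2 ^ 0 * 3 ^ j * F l) := by gcongr
        _ = _ := by ring
  | succ i ih =>
    have := h2 (2 ^ i * 3 ^ j * l) (hl.trans (Nat.le_mul_of_pos_left _ (by positivity)))
    rw [show 2 ^ (i + 1) * 3 ^ j * l = 2 * (2 ^ i * 3 ^ j * l) by ring]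
    calc _ ≤ _ := this
      _ ≤ 2 * (2 ^ i * 3 ^ j * F l) := by gcongr
      _ = _ := by ring

lemma le_add_mul_sub_of_step {F : ℕ → ℝ} {C : ℝ} (hstep : ∀ l, 1 ≤ l → F (l + 1) ≤ F l + C)
    {m n : ℕ} (hm : 1 ≤ m) (hmn : m ≤ n) : F n ≤ F m + C * (n - m) := by
  induction n, hmn using Nat.le_induction with
  | base => simp
  | succ n hn ih =>
    have := hstep n (hm.trans hn)
    push_cast
    linarith

/-- A nonnegative sequence with bounded upward increments satisfying `F (2 * l) ≤ 2 * F l` and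
`F (3 * l) ≤ 3 * F l` for large `l` grows linearly with a well-defined slope. -/
lemma exists_tendsto_div_of_two_three {F : ℕ → ℝ} {C : ℝ} {l₀ : ℕ} (hF : ∀ l, 1 ≤ l → 0 ≤ F l)
    (hC : 0 ≤ C) (hstep : ∀ l, 1 ≤ l → F (l + 1) ≤ F l + C) (hl₀ : 1 ≤ l₀)
    (h2 : ∀ l, l₀ ≤ l → F (2 * l) ≤ 2 * F l) (h3 : ∀ l, l₀ ≤ l → F (3 * l) ≤ 3 * F l) :
    ∃ L : ℝ, Tendsto (fun n : ℕ => F n / n) atTop (𝓝 L) := by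
  set S : Set ℝ := (fun l : ℕ => F l / l) '' Set.Ici l₀
  have hbdd : BddBelow S := by
    refine ⟨0, ?_⟩
    rintro _ ⟨l, hl, rfl⟩
    exact div_nonneg (hF l (hl₀.trans hl)) l.cast_nonneg
  have hne : S.Nonempty := ⟨_, l₀, Set.mem_Ici.2 le_rfl, rfl⟩
  refine ⟨sInf S, tendsto_order.2 ⟨fun b hb => ?_, fun b hb => ?_⟩⟩
  · filter_upwards [eventually_ge_atTop l₀] with n hn
    exact hb.trans_le (csInf_le hbdd ⟨n, hn, rfl⟩)
  · obtain ⟨_, ⟨l, hl, rfl⟩, hlb⟩ := exists_lt_of_csInf_lt hne hb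
    have hl' : l₀ ≤ l := hl
    have hlpos : (0 : ℝ) < l := by exact_mod_cast hl₀.trans hl'
    set s := F l / l with hs
    have hFl : F l = s * l := by rw [hs]; field_simp
    have hs0 : 0 ≤ s := div_nonneg (hF l (hl₀.trans hl')) hlpos.le
    have hlb' : s < b := hlb
    set ε := (b - s) / (C + 1) with hε
    have hε0 : 0 < ε := div_pos (by linarith) (by linarith)
    have hεC : C * ε < b - s := by
      have : ε * (C + 1) = b - s := by rw [hε]; field_simp
      linarith
    have hx : Tendsto (fun n : ℕ => (n : ℝ) / l) atTop atTop :=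
      tendsto_natCast_atTop_atTop.atTop_div_const hlpos
    filter_upwards [hx.eventually (eventually_exists_two_pow_mul_three_pow_near hε0),
      eventually_gt_atTop 0] with n ⟨i, j, hle, hlt⟩ hn
    have hnpos : (0 : ℝ) < n := by exact_mod_cast hn
    rw [le_div_iff₀ hlpos] at hle
    rw [div_lt_iff₀ hlpos] at hlt
    have hF1 := le_two_pow_mul_three_pow_mul h2 h3 hl' i j
    have hle' : 2 ^ i * 3 ^ j * l ≤ n := by exact_mod_cast hle
    have hF2 := le_add_mul_sub_of_step hstep
      (Nat.mul_pos (by positivity) (hl₀.trans hl') : 1 ≤ 2 ^ i * 3 ^ j * l) hle'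
    push_cast at hF2
    set M : ℝ := 2 ^ i * 3 ^ j * l
    rw [div_lt_iff₀ hnpos]
    calc F n ≤ s * M + C * (n - M) := by rw [hFl] at hF1; linarith
      _ ≤ s * n + C * (ε * n) := by
        have : (n : ℝ) - M ≤ ε * n := by nlinarith
        gcongr
      _ = (s + C * ε) * n := by ring
      _ < b * n := by gcongr; linarith

/-- The defect `2 * log l` is absorbed by adding a multiple of `√l`. -/
lemma two_mul_log_add_mul_sqrt_le {l k : ℝ} (hl : 1 ≤ l) (hk : 2 ≤ k) :
    2 * Real.log l + 10 * √(k * l) ≤ k * (10 * √l) := by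
  have hlog : Real.log l ≤ 2 * √l := by
    have := Real.log_le_self (Real.sqrt_nonneg l)
    rw [Real.log_sqrt (by linarith)] at this
    linarith
  rw [Real.sqrt_mul (by linarith)]
  have hk' : √k ≤ k - 0.4 := by
    rw [Real.sqrt_le_left (by linarith)]
    nlinarith
  nlinarith [Real.sqrt_nonneg l]

/-- **Theorem (deterministic 2-3 method).** Let `a` be a sequence with `0 < a(l) ≤ 1`, such
that `a(l+1) ≥ c·a(l)` for some `c > 0`, and such that for all large `l`,
`a(l)² ≤ l²·a(2l)` and `a(l)³ ≤ l²·a(3l)`. Then `lim_l a(l)^{1/l}` exists and is strictly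
positive. -/
theorem two_three_method
    (a : ℕ → ℝ) (h01 : ∀ l : ℕ, 1 ≤ l → 0 < a l ∧ a l ≤ 1)
    (c : ℝ) (hc : 0 < c) (hstep : ∀ l : ℕ, 1 ≤ l → c * a l ≤ a (l + 1))
    (h23 : ∃ l₀ : ℕ, ∀ l : ℕ, l₀ ≤ l →
      a l ^ 2 ≤ (l : ℝ) ^ 2 * a (2 * l) ∧ a l ^ 3 ≤ (l : ℝ) ^ 2 * a (3 * l)) :
    ∃ L : ℝ, 0 < L ∧
      Tendsto (fun l : ℕ => a l ^ (1 / (l : ℝ))) atTop (nhds L) := by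
  obtain ⟨l₀, h23⟩ := h23
  set F : ℕ → ℝ := fun l => -Real.log (a l) + 10 * √l with hF
  have hmul : ∀ k l : ℕ, 2 ≤ k → 1 ≤ l → a l ^ k ≤ (l : ℝ) ^ 2 * a (k * l) →
      F (k * l) ≤ k * F l := by
    intro k l hk hl h
    have hl1 : (1 : ℝ) ≤ l := by exact_mod_cast hl
    have hal := (h01 l hl).1
    have hakl := (h01 (k * l) (Nat.mul_pos (by omega) hl)).1
    have hlog := Real.log_le_log (by positivity) h
    rw [Real.log_pow, Real.log_mul (by positivity) hakl.ne', Real.log_pow] at hlog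
    have := two_mul_log_add_mul_sqrt_le hl1 (by exact_mod_cast hk : (2 : ℝ) ≤ k)
    simp only [hF]
    push_cast at *
    linarith
  have hFstep : ∀ l, 1 ≤ l → F (l + 1) ≤ F l + (|Real.log c| + 10) := by
    intro l hl
    have hal := (h01 l hl).1
    have hlog := Real.log_le_log (by positivity) (hstep l hl)
    rw [Real.log_mul hc.ne' hal.ne'] at hlog
    have hsqrt : √((l : ℝ) + 1) ≤ √l + 1 := by
      rw [Real.sqrt_le_left (by positivity)]
      nlinarith [Real.sq_sqrt (Nat.cast_nonneg (α := ℝ) l), Real.sqrt_nonneg (l : ℝ)]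
    have := neg_abs_le (Real.log c)
    simp only [hF]
    push_cast
    linarith
  obtain ⟨L, hL⟩ := exists_tendsto_div_of_two_three (F := F) (l₀ := max l₀ 1)
    (fun l hl => add_nonneg
      (neg_nonneg.2 (Real.log_nonpos (h01 l hl).1.le (h01 l hl).2)) (by positivity))
    (by positivity) hFstep (le_max_right _ _)
    (fun l hl => by
      exact_mod_cast hmul 2 l le_rfl (le_of_max_le_right hl) (h23 l (le_of_max_le_left hl)).1)
    (fun l hl => by
      exact_mod_cast hmul 3 l (by norm_num) (le_of_max_le_right hl)
        (h23 l (le_of_max_le_left hl)).2)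
  have hsqrt : Tendsto (fun n : ℕ => 10 * (√(n : ℝ))⁻¹) atTop (𝓝 (10 * 0)) :=
    ((Real.tendsto_sqrt_atTop.comp tendsto_natCast_atTop_atTop).inv_tendsto_atTop).const_mul 10
  refine ⟨Real.exp (-(L - 10 * 0)), Real.exp_pos _, ?_⟩
  refine ((Real.continuous_exp.tendsto _).comp (hL.sub hsqrt).neg).congr' ?_
  filter_upwards [eventually_ge_atTop 1] with n hn
  have hnpos : (0 : ℝ) < n := by exact_mod_cast hn
  rw [Real.rpow_def_of_pos (h01 n hn).1]
  simp only [Function.comp, hF, ← Real.sqrt_div_self]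
  congr 1
  field_simp
  ring

end GrowthURT
end
end

section
/- Let (α_n)_{n≥0} be a sequence of real numbers with |α_{n+1} − α_n| ≤ C for all n, for some constant C. For each integer m ≥ 1 let A_m be the closure in ℝ² of the set { (r/n, α_r/n) : r ∈ ℕ, n ≥ m }, and let 𝒞 = ∩_{m≥1} A_m. Then 𝒞 is exactly the closed cone { (x,y) ∈ ℝ² : x ≥ 0 and x·liminf_{n→∞}(α_n/n) ≤ y ≤ x·limsup_{n→∞}(α_n/n) }. In particular, lim_{n→∞} α_n/n exists if and only if 𝒞 is a half line. -/
open MeasureTheory Filter Topology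
open scoped Classical ENNReal

noncomputable section

namespace GrowthURT

/-- A sequence with bounded increments grows at most linearly. -/
lemma abs_le_of_abs_sub_le {α : ℕ → ℝ} {C : ℝ} (hC : ∀ n : ℕ, |α (n + 1) - α n| ≤ C) (n : ℕ) :
    |α n| ≤ |α 0| + C * n := by
  induction n with
  | zero => simp
  | succ k ih =>
    have h := hC k
    have h' := abs_add_le (α (k + 1) - α k) (α k)
    rw [sub_add_cancel] at h'
    push_cast
    linarith

lemma abs_div_le_of_abs_sub_le {α : ℕ → ℝ} {C : ℝ} (hC : ∀ n : ℕ, |α (n + 1) - α n| ≤ C)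
    (n : ℕ) : |α n / n| ≤ |α 0| + C := by
  have hC0 : 0 ≤ C := (abs_nonneg _).trans (hC 0)
  rcases Nat.eq_zero_or_pos n with rfl | hn
  · simpa using add_nonneg (abs_nonneg (α 0)) hC0
  · have hn' : (1 : ℝ) ≤ n := by exact_mod_cast hn
    rw [abs_div, Nat.abs_cast, div_le_iff₀ (by linarith)]
    nlinarith [abs_le_of_abs_sub_le hC n, abs_nonneg (α 0)]

lemma tendsto_div_succ_sub_div {α : ℕ → ℝ} {C : ℝ} (hC : ∀ n : ℕ, |α (n + 1) - α n| ≤ C) :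
    Tendsto (fun n : ℕ => α (n + 1) / (n + 1 : ℕ) - α n / n) atTop (𝓝 0) := by
  have hlim : Tendsto (fun n : ℕ => (C + (|α 0| + C)) * (1 / ((n : ℝ) + 1))) atTop (𝓝 0) := by
    simpa using tendsto_one_div_add_atTop_nhds_zero_nat.const_mul (C + (|α 0| + C))
  refine squeeze_zero_norm' ?_ hlim
  filter_upwards [eventually_ge_atTop 1] with n hn
  have hn' : (0 : ℝ) < n := by exact_mod_cast hn
  have heq : α (n + 1) / (n + 1 : ℕ) - α n / n =
      ((α (n + 1) - α n) - α n / n) * (1 / ((n : ℝ) + 1)) := by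
    push_cast
    field_simp
    ring
  rw [heq, Real.norm_eq_abs, abs_mul, abs_of_pos (by positivity : 0 < 1 / ((n : ℝ) + 1))]
  gcongr
  exact (abs_sub _ _).trans (add_le_add (hC n) (abs_div_le_of_abs_sub_le hC n))

/-- If the increments of a bounded real sequence tend to zero, every value between its lower and
upper limits is a cluster point. -/
lemma frequently_abs_sub_lt {u : ℕ → ℝ} {K : ℝ} (hK : ∀ n, |u n| ≤ K)
    (hu : Tendsto (fun n => u (n + 1) - u n) atTop (𝓝 0)) {t : ℝ}
    (hl : liminf u atTop ≤ t) (hL : t ≤ limsup u atTop) {ε : ℝ} (hε : 0 < ε) :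
    ∃ᶠ n in atTop, |u n - t| < ε := by
  intro hfar
  have hstep : ∀ᶠ n in atTop, |u (n + 1) - u n| < ε := by
    simpa using hu.eventually (Metric.ball_mem_nhds 0 hε)
  obtain ⟨N, hN⟩ := eventually_atTop.1 (hfar.and hstep)
  have hfar' : ∀ n ≥ N, u n ≤ t - ε ∨ t + ε ≤ u n := fun n hn => by
    rcases le_abs.1 (not_lt.1 (hN n hn).1) with h | h
    · right; linarith
    · left; linarith
  rcases hfar' N le_rfl with h0 | h0
  · have hall : ∀ n ≥ N, u n ≤ t - ε := fun n hn => by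
      induction n, hn using Nat.le_induction with
      | base => exact h0
      | succ n hn ih =>
        have := abs_lt.1 (hN n hn).2
        rcases hfar' (n + 1) (by lia) with h | h <;> linarith
    have : limsup u atTop ≤ t - ε := limsup_le_of_le
      (isCoboundedUnder_le_of_le atTop fun n => (abs_le.1 (hK n)).1)
      (eventually_atTop.2 ⟨N, hall⟩)
    linarith
  · have hall : ∀ n ≥ N, t + ε ≤ u n := fun n hn => by
      induction n, hn using Nat.le_induction with
      | base => exact h0
      | succ n hn ih =>
        have := abs_lt.1 (hN n hn).2
        rcases hfar' (n + 1) (by lia) with h | h <;> linarith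
    have : t + ε ≤ liminf u atTop := le_liminf_of_le
      (isCoboundedUnder_ge_of_le atTop fun n => (abs_le.1 (hK n)).2)
      (eventually_atTop.2 ⟨N, hall⟩)
    linarith

/-- A linear functional bounded above along the graph of `α` is nonpositive on the cone. -/
lemma linear_nonpos_of_mem_iInter_closure {α : ℕ → ℝ} {p : ℝ × ℝ}
    (hp : ∀ m : ℕ, 1 ≤ m → p ∈ closure
      {p : ℝ × ℝ | ∃ r n : ℕ, m ≤ n ∧ p = ((r : ℝ) / n, α r / n)})
    {a b : ℝ} (hab : ∀ᶠ r : ℕ in atTop, a * r + b * α r ≤ 0) :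
    a * p.1 + b * p.2 ≤ 0 := by
  obtain ⟨K, hK0, hK⟩ : ∃ K : ℝ, 0 ≤ K ∧ ∀ r : ℕ, a * r + b * α r ≤ K := by
    obtain ⟨N, hN⟩ := eventually_atTop.1 hab
    refine ⟨∑ r ∈ Finset.range N, |a * r + b * α r|,
      Finset.sum_nonneg fun _ _ => abs_nonneg _, fun r => ?_⟩
    rcases lt_or_ge r N with h | h
    · exact (le_abs_self _).trans (Finset.single_le_sum
        (f := fun r : ℕ => |a * r + b * α r|) (fun _ _ => abs_nonneg _) (Finset.mem_range.2 h))
    · exact (hN r h).trans (Finset.sum_nonneg fun _ _ => abs_nonneg _)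
  refine ge_of_tendsto (tendsto_const_div_atTop_nhds_zero_nat K) ?_
  filter_upwards [eventually_ge_atTop 1] with m hm
  have hclosed : IsClosed {q : ℝ × ℝ | a * q.1 + b * q.2 ≤ K / m} :=
    isClosed_le (by fun_prop) continuous_const
  refine closure_minimal ?_ hclosed (hp m hm)
  rintro _ ⟨r, n, hmn, rfl⟩
  have hm' : (0 : ℝ) < m := by exact_mod_cast hm
  have hmn' : (m : ℝ) ≤ n := by exact_mod_cast hmn
  calc a * ((r : ℝ) / n) + b * (α r / n) = (a * r + b * α r) / n := by ring
    _ ≤ K / n := by gcongr; exact hK r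
    _ ≤ K / m := by gcongr

/-- A point on a ray whose slope is a cluster point of `α n / n` lies in the cone. -/
lemma mem_closure_of_frequently_abs_sub_lt {α : ℕ → ℝ} {x t : ℝ} (hx : 0 < x)
    (h : ∀ ε > 0, ∃ᶠ n : ℕ in atTop, |α n / n - t| < ε) (m : ℕ) :
    (x, x * t) ∈ closure
      {p : ℝ × ℝ | ∃ r n : ℕ, m ≤ n ∧ p = ((r : ℝ) / n, α r / n)} := by
  have hcluster : MapClusterPt t atTop fun n : ℕ => α n / n :=
    mapClusterPt_iff_frequently.2 fun s hs => by
      obtain ⟨ε, hε, hs⟩ := Metric.mem_nhds_iff.1 hs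
      exact (h ε hε).mono fun n hn => hs hn
  obtain ⟨φ, hφ, hlim⟩ := hcluster.tendsto_subseq
  have hφ' : Tendsto (fun k => (φ k : ℝ)) atTop atTop :=
    tendsto_natCast_atTop_atTop.comp hφ.tendsto_atTop
  have hratio : Tendsto (fun k => (φ k : ℝ) / ⌈x⁻¹ * φ k⌉₊) atTop (𝓝 x) := by
    have := ((tendsto_nat_ceil_mul_div_atTop (inv_nonneg.2 hx.le)).comp hφ').inv₀
      (inv_ne_zero hx.ne')
    simpa [Function.comp_def] using this
  have hceil : Tendsto (fun k => ⌈x⁻¹ * (φ k : ℝ)⌉₊) atTop atTop :=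
    tendsto_nat_ceil_atTop.comp (hφ'.const_mul_atTop (inv_pos.2 hx))
  refine mem_closure_of_tendsto (hratio.prodMk_nhds (hratio.mul hlim)) ?_
  filter_upwards [hceil.eventually_ge_atTop m, hφ.tendsto_atTop.eventually_ge_atTop 1]
    with k hk hk1
  have hk1' : (φ k : ℝ) ≠ 0 := by exact_mod_cast (by lia : φ k ≠ 0)
  refine ⟨φ k, _, hk, Prod.ext rfl ?_⟩
  simp only [Function.comp_apply]
  field_simp

/-- **Lemma (the cone of a Lipschitz sequence).** Let `(αₙ)` be a real sequence with
`|α_{n+1} - αₙ| ≤ C`. For `m ≥ 1` let `A_m` be the closure of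
`{(r/n, α_r/n) : r ∈ ℕ, n ≥ m}` in `ℝ²`, and `𝒞 = ⋂_{m ≥ 1} A_m`. Then `𝒞` is exactly the
closed cone `{(x,y) : x ≥ 0, x·liminf(αₙ/n) ≤ y ≤ x·limsup(αₙ/n)}`. -/
theorem cone_of_lipschitz_sequence
    (α : ℕ → ℝ) (C : ℝ) (hC : ∀ n : ℕ, |α (n + 1) - α n| ≤ C) :
    (⋂ m ∈ Set.Ici 1, closure
        {p : ℝ × ℝ | ∃ r n : ℕ, m ≤ n ∧ p = ((r : ℝ) / n, α r / n)}) =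
      {p : ℝ × ℝ | 0 ≤ p.1 ∧
        p.1 * liminf (fun n : ℕ => α n / n) atTop ≤ p.2 ∧
        p.2 ≤ p.1 * limsup (fun n : ℕ => α n / n) atTop} := by
  have hK := abs_div_le_of_abs_sub_le hC
  ext ⟨x, y⟩
  simp only [Set.mem_iInter, Set.mem_Ici, Set.mem_ofPred_eq]
  constructor
  · intro hp
    have hx : 0 ≤ x := by
      have := linear_nonpos_of_mem_iInter_closure hp (a := -1) (b := 0)
        (Eventually.of_forall fun r => by simp)
      simpa using this
    refine ⟨hx, ?_, ?_⟩
    · have hlim : ∀ c < liminf (fun n : ℕ => α n / n) atTop, x * c ≤ y := fun c hc => by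
        have hev := eventually_lt_of_lt_liminf hc
          (isBoundedUnder_of ⟨_, fun n => (abs_le.1 (hK n)).1⟩)
        have := linear_nonpos_of_mem_iInter_closure hp (a := c) (b := -1) <| by
          filter_upwards [hev, eventually_gt_atTop 0] with r hr hr0
          rw [lt_div_iff₀ (by exact_mod_cast hr0)] at hr
          linarith
        linarith
      refine le_of_tendsto (f := fun c => x * c)
        (x := 𝓝[<] (liminf (fun n : ℕ => α n / n) atTop))
        ((tendsto_id.mono_left nhdsWithin_le_nhds).const_mul x) ?_
      filter_upwards [self_mem_nhdsWithin] with c hc using hlim c hc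
    · have hlim : ∀ c > limsup (fun n : ℕ => α n / n) atTop, y ≤ x * c := fun c hc => by
        have hev := eventually_lt_of_limsup_lt hc
          (isBoundedUnder_of ⟨_, fun n => (abs_le.1 (hK n)).2⟩)
        have := linear_nonpos_of_mem_iInter_closure hp (a := -c) (b := 1) <| by
          filter_upwards [hev, eventually_gt_atTop 0] with r hr hr0
          rw [div_lt_iff₀ (by exact_mod_cast hr0)] at hr
          linarith
        linarith
      refine ge_of_tendsto (f := fun c => x * c)
        (x := 𝓝[>] (limsup (fun n : ℕ => α n / n) atTop))
        ((tendsto_id.mono_left nhdsWithin_le_nhds).const_mul x) ?_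
      filter_upwards [self_mem_nhdsWithin] with c hc using hlim c hc
  · rintro ⟨hx, hl, hL⟩ m -
    rcases hx.eq_or_lt with rfl | hx
    · obtain rfl : y = 0 := by linarith
      refine mem_closure_of_tendsto (f := fun n : ℕ => (((0 : ℕ) : ℝ) / n, α 0 / n)) (b := atTop)
        ?_ ((eventually_ge_atTop m).mono fun n hn => ⟨0, n, hn, rfl⟩)
      exact (tendsto_const_div_atTop_nhds_zero_nat _).prodMk_nhds
        (tendsto_const_div_atTop_nhds_zero_nat _)
    · have := mem_closure_of_frequently_abs_sub_lt hx (t := y / x) (fun ε hε =>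
        frequently_abs_sub_lt hK (tendsto_div_succ_sub_div hC)
          ((le_div_iff₀' hx).2 hl) ((div_le_iff₀' hx).2 hL) hε) m
      rwa [mul_div_cancel₀ _ hx.ne'] at this

end GrowthURT
end
end

section
/- The rate function I : [0,1] → ℝ is strictly concave, and its right derivative at 0 exists and equals (1/2)·log(d−1). -/
open MeasureTheory Filter Topology
open scoped Classical ENNReal

noncomputable section

namespace GrowthURT


/-- `r = (1/2 + √(d-1)/d)⁻¹`. -/
def rConst (d : ℕ) : ℝ := (1 / 2 + Real.sqrt ((d : ℝ) - 1) / d)⁻¹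

/-- `s = (1/2 − √(d-1)/d)⁻¹`. -/
def sConst (d : ℕ) : ℝ := (1 / 2 - Real.sqrt ((d : ℝ) - 1) / d)⁻¹

/-- The function `F(x) = (d/((d-1)x)) · ((1 - x/2) - √((1-x/r)(1-x/s)))`. -/
def Ffun (d : ℕ) (x : ℝ) : ℝ :=
  ((d : ℝ) / (((d : ℝ) - 1) * x)) *
    ((1 - x / 2) - Real.sqrt ((1 - x / rConst d) * (1 - x / sConst d)))

/-- `φ(t) = inf_{0 < x ≤ r} (t·log F(x) - log x)`. -/
def phiFun (d : ℕ) (t : ℝ) : ℝ :=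
  sInf ((fun x => t * Real.log (Ffun d x) - Real.log x) '' Set.Ioc 0 (rConst d))

/-- The rate function `I(t) = φ(t) + t·log(d-1)`. -/
def rateFun (d : ℕ) (t : ℝ) : ℝ := phiFun d t + t * Real.log ((d : ℝ) - 1)

open Real in
/-- The logarithm of `1/x` in the parametrization `1/x = 1/2 + c cosh θ`. -/
def logCosh (c θ : ℝ) : ℝ := log (1 / 2 + c * cosh θ)

lemma half_add_mul_cosh_pos {c : ℝ} (hc : 0 < c) (θ : ℝ) : 0 < 1 / 2 + c * Real.cosh θ := by
  have := Real.cosh_pos θ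
  positivity

lemma abs_add_log_le_logCosh {c : ℝ} (hc : 0 < c) (θ : ℝ) :
    |θ| + Real.log (c / 2) ≤ logCosh c θ := by
  have h2 : 0 < c / 2 := by positivity
  rw [logCosh, ← Real.log_exp |θ|, ← Real.log_mul (Real.exp_pos _).ne' h2.ne']
  apply Real.log_le_log (by positivity)
  rw [← Real.cosh_abs, Real.cosh_eq]
  have := mul_pos hc (Real.exp_pos (-|θ|))
  nlinarith

lemma continuous_logCosh {c : ℝ} (hc : 0 < c) : Continuous (logCosh c) := by
  unfold logCosh
  exact Continuous.log (by fun_prop) fun θ => (half_add_mul_cosh_pos hc θ).ne'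

lemma hasDerivAt_logCosh {c : ℝ} (hc : 0 < c) (θ : ℝ) :
    HasDerivAt (logCosh c) (c * Real.sinh θ / (1 / 2 + c * Real.cosh θ)) θ :=
  (((Real.hasDerivAt_cosh θ).const_mul c).const_add (1 / 2)).log
    (half_add_mul_cosh_pos hc θ).ne'

lemma exists_logCosh_sub_minimizer {c t : ℝ} (hc : 0 < c) (h0 : 0 ≤ t) (h1 : t < 1) :
    ∃ θ, ∀ η, logCosh c θ - t * θ ≤ logCosh c η - t * η := by
  have hcont : Continuous fun θ => logCosh c θ - t * θ :=
    (continuous_logCosh hc).sub (by fun_prop)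
  refine hcont.exists_forall_le ?_
  have hlim : Tendsto (fun θ : ℝ => (1 - t) * |θ| + Real.log (c / 2)) (cocompact ℝ) atTop :=
    tendsto_atTop_add_const_right _ _
      ((tendsto_norm_cocompact_atTop (E := ℝ)).const_mul_atTop (sub_pos.2 h1))
  refine tendsto_atTop_mono (fun θ => ?_) hlim
  have := abs_add_log_le_logCosh hc θ
  have := mul_le_mul_of_nonneg_left (le_abs_self θ) h0
  linarith

lemma eq_of_logCosh_sub_minimizer {c t θ : ℝ} (hc : 0 < c)
    (h : ∀ η, logCosh c θ - t * θ ≤ logCosh c η - t * η) :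
    c * Real.sinh θ / (1 / 2 + c * Real.cosh θ) = t := by
  have hmin : IsLocalMin (fun η => logCosh c η - t * η) θ := Eventually.of_forall h
  have := hmin.hasDerivAt_eq_zero ((hasDerivAt_logCosh hc θ).sub ((hasDerivAt_id θ).const_mul t))
  linarith

lemma logCosh_zero_le {c : ℝ} (hc : 0 < c) (θ : ℝ) : logCosh c 0 ≤ logCosh c θ := by
  unfold logCosh
  refine Real.log_le_log (half_add_mul_cosh_pos hc 0) ?_
  rw [Real.cosh_zero]
  have := Real.one_le_cosh θ
  nlinarith

lemma logCosh_zero_sub_sq_le {c t : ℝ} (hc : 0 < c) (h0 : 0 ≤ t) (h1 : t ≤ 1 / 2) (θ : ℝ) :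
    logCosh c 0 - (1 + 2 * c) / c * t ^ 2 ≤ logCosh c θ - t * θ := by
  obtain ⟨η, hη⟩ := exists_logCosh_sub_minimizer hc h0 (by linarith)
  refine le_trans ?_ (hη θ)
  have hfoc := eq_of_logCosh_sub_minimizer hc hη
  rw [div_eq_iff (half_add_mul_cosh_pos hc η).ne'] at hfoc
  have hK : 0 ≤ (1 + 2 * c) / c := by positivity
  have hbound : η ≤ (1 + 2 * c) / c * t := by
    rcases le_total η 0 with hneg | hpos
    · exact hneg.trans (by positivity)
    have hs : η ≤ Real.sinh η := Real.self_le_sinh_iff.2 hpos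
    have hcosh : Real.cosh η ≤ 1 + Real.sinh η := by
      have := Real.cosh_sub_sinh η
      have : Real.exp (-η) ≤ 1 := Real.exp_le_one_iff.2 (by linarith)
      linarith
    have h2 : c * Real.sinh η ≤ t * (1 / 2 + c * (1 + Real.sinh η)) := by
      rw [hfoc]; gcongr
    have h3 : t * (c * Real.sinh η) ≤ 1 / 2 * (c * Real.sinh η) :=
      mul_le_mul_of_nonneg_right h1 (mul_nonneg hc.le (hpos.trans hs))
    have h4 : c * η ≤ c * Real.sinh η := by gcongr
    rw [div_mul_eq_mul_div, le_div_iff₀ hc]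
    nlinarith
  have h5 := logCosh_zero_le hc η
  have h6 := mul_le_mul_of_nonneg_left hbound h0
  nlinarith

section Parametrization

variable {d : ℕ}

lemma sqrt_div_pos (hd : 3 ≤ d) : 0 < √((d : ℝ) - 1) / d := by
  have hd' : (3 : ℝ) ≤ d := by exact_mod_cast hd
  have : 0 < √((d : ℝ) - 1) := Real.sqrt_pos.2 (by linarith)
  positivity

lemma Ffun_inv_half_add_mul_cosh (hd : 3 ≤ d) {θ : ℝ} (hθ : 0 ≤ θ) :
    Ffun d (1 / 2 + √((d : ℝ) - 1) / d * Real.cosh θ)⁻¹ =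
      (√((d : ℝ) - 1))⁻¹ * Real.exp (-θ) := by
  have hc := sqrt_div_pos hd
  have hy := half_add_mul_cosh_pos hc θ
  have hd' : (3 : ℝ) ≤ d := by exact_mod_cast hd
  have hq : 0 < √((d : ℝ) - 1) := Real.sqrt_pos.2 (by linarith)
  have hq2 : (d : ℝ) - 1 = √((d : ℝ) - 1) ^ 2 := (Real.sq_sqrt (by linarith)).symm
  rw [Ffun, rConst, sConst, div_inv_eq_mul, div_inv_eq_mul]
  set q := √((d : ℝ) - 1) with hqdef
  set c := q / d with hcdef
  set y := 1 / 2 + c * Real.cosh θ with hydef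
  have hprod : (1 - y⁻¹ * (1 / 2 + c)) * (1 - y⁻¹ * (1 / 2 - c)) =
      (y⁻¹ * (c * Real.sinh θ)) ^ 2 := by
    field_simp
    have := Real.cosh_sq θ
    have h : Real.sinh θ ^ 2 = Real.cosh θ ^ 2 - 1 := by linarith
    rw [h, hydef]
    ring
  have hs : 0 ≤ Real.sinh θ := Real.sinh_nonneg_iff.2 hθ
  have hu : 1 - y⁻¹ / 2 = y⁻¹ * (c * Real.cosh θ) := by
    field_simp
    rw [hydef]
    ring
  rw [hprod, Real.sqrt_sq (by positivity), hu, ← Real.cosh_sub_sinh, hq2, hcdef]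
  field_simp

lemma image_Ioc_rConst (hd : 3 ≤ d) (t : ℝ) :
    (fun x => t * Real.log (Ffun d x) - Real.log x) '' Set.Ioc 0 (rConst d) =
      (fun θ => logCosh (√((d : ℝ) - 1) / d) θ - t * θ - t * (1 / 2 * Real.log ((d : ℝ) - 1))) ''
        Set.Ici 0 := by
  have hc := sqrt_div_pos hd
  have hd' : (3 : ℝ) ≤ d := by exact_mod_cast hd
  have hq : 0 < √((d : ℝ) - 1) := Real.sqrt_pos.2 (by linarith)
  have himage : Set.Ioc 0 (rConst d) =
      (fun θ => (1 / 2 + √((d : ℝ) - 1) / d * Real.cosh θ)⁻¹) '' Set.Ici 0 := by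
    ext x
    constructor
    · rintro ⟨hx0, hxr⟩
      have hx : 1 / 2 + √((d : ℝ) - 1) / d ≤ x⁻¹ := (le_inv_comm₀ hx0 (by positivity)).1 hxr
      have h1 : 1 ≤ (x⁻¹ - 1 / 2) / (√((d : ℝ) - 1) / d) := by
        rw [le_div_iff₀ hc]
        linarith
      refine ⟨Real.arcosh _, Real.arcosh_nonneg h1, ?_⟩
      simp only
      rw [Real.cosh_arcosh h1, mul_div_cancel₀ _ hc.ne', add_sub_cancel, inv_inv]
    · rintro ⟨θ, -, rfl⟩
      refine ⟨inv_pos.2 (half_add_mul_cosh_pos hc θ), inv_anti₀ (by positivity) ?_⟩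
      have := mul_le_mul_of_nonneg_left (Real.one_le_cosh θ) hc.le
      linarith
  rw [himage, Set.image_image]
  refine Set.image_congr fun θ hθ => ?_
  rw [Ffun_inv_half_add_mul_cosh hd hθ, Real.log_mul (inv_pos.2 hq).ne' (Real.exp_pos _).ne',
    Real.log_exp, Real.log_inv, Real.log_inv, Real.log_sqrt (by linarith), logCosh]
  ring

lemma isGLB_rateFun (hd : 3 ≤ d) {t : ℝ} (ht : t ∈ Set.Icc (0 : ℝ) 1) :
    IsGLB (Set.range fun θ => logCosh (√((d : ℝ) - 1) / d) θ - t * θ)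
      (rateFun d t - t * (1 / 2 * Real.log ((d : ℝ) - 1))) := by
  have hc := sqrt_div_pos hd
  set g := logCosh (√((d : ℝ) - 1) / d) with hg
  set a := t * (1 / 2 * Real.log ((d : ℝ) - 1)) with ha
  have hbelow : ∀ θ, Real.log (√((d : ℝ) - 1) / d / 2) ≤ g θ - t * θ := fun θ => by
    have h1 := abs_add_log_le_logCosh hc θ
    have h2 := mul_le_mul_of_nonneg_left (le_abs_self θ) ht.1
    have h3 := mul_le_mul_of_nonneg_right ht.2 (abs_nonneg θ)
    linarith
  have hglb : IsGLB ((fun θ => g θ - t * θ - a) '' Set.Ici 0) (phiFun d t) := by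
    rw [phiFun, image_Ioc_rConst hd t]
    refine isGLB_csInf (Set.nonempty_Ici.image _) ⟨Real.log (√((d : ℝ) - 1) / d / 2) - a, ?_⟩
    rintro _ ⟨θ, -, rfl⟩
    have := hbelow θ
    simp only
    linarith
  have hrate : rateFun d t - a = phiFun d t + a := by
    rw [rateFun, ha]
    ring
  rw [hrate]
  constructor
  · rintro _ ⟨θ, rfl⟩
    have h1 := hglb.1 ⟨|θ|, abs_nonneg θ, rfl⟩
    have h2 := mul_le_mul_of_nonneg_left (le_abs_self θ) ht.1
    have h3 : g |θ| = g θ := by rw [hg, logCosh, logCosh, Real.cosh_abs]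
    simp only [h3] at h1 ⊢
    linarith
  · intro m hm
    have : m - a ≤ phiFun d t := hglb.2 (by
      rintro _ ⟨θ, -, rfl⟩
      have := hm ⟨θ, rfl⟩
      simp only at this ⊢
      linarith)
    linarith

end Parametrization

/-- **Lemma.** The rate function `I` is strictly concave on `[0,1]` and its right
derivative at `0` exists and equals `(1/2)·log(d-1)`. -/
theorem rateFun_strictConcave_and_deriv (d : ℕ) (hd : 3 ≤ d) :
    StrictConcaveOn ℝ (Set.Icc 0 1) (rateFun d) ∧
      HasDerivWithinAt (rateFun d) ((1 / 2) * Real.log ((d : ℝ) - 1)) (Set.Icc 0 1) 0 := by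
  have hc := sqrt_div_pos hd
  set c := √((d : ℝ) - 1) / d with hcdef
  set b := 1 / 2 * Real.log ((d : ℝ) - 1) with hb
  have hle : ∀ t ∈ Set.Icc (0 : ℝ) 1, ∀ θ, rateFun d t - t * b ≤ logCosh c θ - t * θ :=
    fun t ht θ => (isGLB_rateFun hd ht).1 ⟨θ, rfl⟩
  refine ⟨⟨convex_Icc 0 1, fun t₁ h₁ t₂ h₂ hne a₁ a₂ ha₁ ha₂ hsum => ?_⟩, ?_⟩
  · simp only [smul_eq_mul]
    have hmem : a₁ * t₁ + a₂ * t₂ ∈ Set.Ico (0 : ℝ) 1 := by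
      refine ⟨add_nonneg (mul_nonneg ha₁.le h₁.1) (mul_nonneg ha₂.le h₂.1), ?_⟩
      rcases hne.lt_or_gt with h | h
      · nlinarith [mul_pos ha₁ (sub_pos.2 h), h₂.2]
      · nlinarith [mul_pos ha₂ (sub_pos.2 h), h₁.2]
    set t := a₁ * t₁ + a₂ * t₂ with ht
    obtain ⟨θ, hθ⟩ := exists_logCosh_sub_minimizer hc hmem.1 hmem.2
    have hfoc := eq_of_logCosh_sub_minimizer hc hθ
    have hval : logCosh c θ - t * θ ≤ rateFun d t - t * b :=
      (isGLB_rateFun hd ⟨hmem.1, hmem.2.le⟩).2 (by rintro _ ⟨η, rfl⟩; exact hθ η)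
    have hlt : ∀ u ∈ Set.Icc (0 : ℝ) 1, u ≠ t → rateFun d u - u * b < logCosh c θ - u * θ := by
      refine fun u hu hut => (hle u hu θ).lt_of_ne fun heq => hut ?_
      rw [← hfoc]
      exact (eq_of_logCosh_sub_minimizer hc fun η => heq ▸ hle u hu η).symm
    have hne₁ : t₁ ≠ t := fun h => hne <| by
      have : a₂ * (t₁ - t₂) = 0 := by linear_combination t₁ * hsum + h + ht
      exact sub_eq_zero.1 ((mul_eq_zero.1 this).resolve_left ha₂.ne')
    have hne₂ : t₂ ≠ t := fun h => hne <| by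
      have : a₁ * (t₁ - t₂) = 0 := by linear_combination -t₂ * hsum - h - ht
      exact sub_eq_zero.1 ((mul_eq_zero.1 this).resolve_left ha₁.ne')
    have k₁ := mul_lt_mul_of_pos_left (hlt t₁ h₁ hne₁) ha₁
    have k₂ := mul_lt_mul_of_pos_left (hlt t₂ h₂ hne₂) ha₂
    have hlin : a₁ * (logCosh c θ - t₁ * θ) + a₂ * (logCosh c θ - t₂ * θ) =
        logCosh c θ - t * θ := by
      rw [ht]
      linear_combination logCosh c θ * hsum
    have hb' : t * b = a₁ * (t₁ * b) + a₂ * (t₂ * b) := by rw [ht]; ring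
    linarith
  · have hzero : rateFun d 0 = logCosh c 0 := by
      have h0 : (0 : ℝ) ∈ Set.Icc (0 : ℝ) 1 := ⟨le_rfl, zero_le_one⟩
      refine le_antisymm (by simpa using hle 0 h0 0) ?_
      have : logCosh c 0 ≤ rateFun d 0 - 0 * b := (isGLB_rateFun hd h0).2 (by
        rintro _ ⟨η, rfl⟩
        simpa using logCosh_zero_le hc η)
      simpa using this
    rw [hasDerivWithinAt_iff_isLittleO]
    have hbig : (fun t => rateFun d t - rateFun d 0 - (t - 0) • b) =O[𝓝[Set.Icc 0 1] 0]
        fun t : ℝ => t ^ 2 := by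
      refine Asymptotics.IsBigO.of_bound ((1 + 2 * c) / c) ?_
      filter_upwards [self_mem_nhdsWithin,
        mem_nhdsWithin_of_mem_nhds (Iic_mem_nhds (by norm_num : (0 : ℝ) < 1 / 2))] with t ht ht'
      have hup := hle t ht 0
      have hlow : logCosh c 0 - (1 + 2 * c) / c * t ^ 2 ≤ rateFun d t - t * b :=
        (isGLB_rateFun hd ht).2 (by
          rintro _ ⟨η, rfl⟩
          exact logCosh_zero_sub_sq_le hc ht.1 ht' η)
      have hnn : 0 ≤ (1 + 2 * c) / c * t ^ 2 := by positivity
      rw [Real.norm_eq_abs, Real.norm_of_nonneg (sq_nonneg t), hzero, abs_le, sub_zero, smul_eq_mul]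
      constructor <;> linarith
    refine hbig.trans_isLittleO ?_
    simpa using (Asymptotics.isLittleO_pow_id one_lt_two).mono nhdsWithin_le_nhds

end GrowthURT
end
end

section
/- Define ψ(t) = √(d²t² + 4(d−1)(1−t²)) and x(t) = (2d/(d−2)²)·(d − ψ(t)) for t ∈ [0,1]. Assume that for every t ∈ (0,1) the infimum defining φ(t) is attained at x = x(t), i.e., φ(t) = t·log F(x(t)) − log x(t). Then φ is twice differentiable on (0,1), with φ'(t) = log F(x(t)) and φ''(t) = −(2d/(d−2)²)·ψ'(t)/(t·x(t)) < 0 for all t ∈ (0,1); in particular lim_{t→0⁺} φ'(t) = −(1/2)·log(d−1). -/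
open MeasureTheory Filter Topology
open scoped Classical ENNReal

noncomputable section

namespace GrowthURT


/-- `ψ(t) = √(d²t² + 4(d-1)(1-t²))`. -/
def psiFun (d : ℕ) (t : ℝ) : ℝ :=
  Real.sqrt ((d : ℝ) ^ 2 * t ^ 2 + 4 * ((d : ℝ) - 1) * (1 - t ^ 2))

/-- `x(t) = (2d/(d-2)²)·(d - ψ(t))`. -/
def xFun (d : ℕ) (t : ℝ) : ℝ :=
  (2 * (d : ℝ) / ((d : ℝ) - 2) ^ 2) * ((d : ℝ) - psiFun d t)

/-- The radicand `d²t² + 4(d-1)(1-t²)` of `ψ` equals `(d-2)²t² + 4(d-1)`. -/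
lemma psiFun_sq {d : ℕ} (hd : 3 ≤ d) (t : ℝ) :
    psiFun d t ^ 2 = ((d : ℝ) - 2) ^ 2 * t ^ 2 + 4 * ((d : ℝ) - 1) := by
  have hD : (3 : ℝ) ≤ d := by exact_mod_cast hd
  have h : (d : ℝ) ^ 2 * t ^ 2 + 4 * ((d : ℝ) - 1) * (1 - t ^ 2)
      = ((d : ℝ) - 2) ^ 2 * t ^ 2 + 4 * ((d : ℝ) - 1) := by ring
  rw [psiFun, h, Real.sq_sqrt]
  nlinarith [mul_nonneg (sq_nonneg ((d : ℝ) - 2)) (sq_nonneg t)]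

lemma psiFun_pos {d : ℕ} (hd : 3 ≤ d) (t : ℝ) : 0 < psiFun d t := by
  have hD : (3 : ℝ) ≤ d := by exact_mod_cast hd
  have h0 : 0 ≤ psiFun d t := Real.sqrt_nonneg _
  refine h0.lt_of_ne fun h => ?_
  have hsq := psiFun_sq hd t
  rw [← h] at hsq
  nlinarith [mul_nonneg (sq_nonneg ((d : ℝ) - 2)) (sq_nonneg t)]

lemma psiFun_lt {d : ℕ} (hd : 3 ≤ d) {t : ℝ} (ht0 : 0 ≤ t) (ht1 : t < 1) : psiFun d t < d := by
  have hD : (3 : ℝ) ≤ d := by exact_mod_cast hd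
  refine lt_of_pow_lt_pow_left₀ 2 (by linarith) ?_
  have ht : 0 < 1 - t ^ 2 := by nlinarith
  have hd2 : 0 < ((d : ℝ) - 2) ^ 2 := by nlinarith
  nlinarith [psiFun_sq hd t, mul_pos hd2 ht]

lemma hasDerivAt_psiFun {d : ℕ} (hd : 3 ≤ d) (t : ℝ) :
    HasDerivAt (psiFun d) (((d : ℝ) - 2) ^ 2 * t / psiFun d t) t := by
  have hpos := psiFun_pos hd t
  have hrad : HasDerivAt
      (fun t : ℝ => (d : ℝ) ^ 2 * t ^ 2 + 4 * ((d : ℝ) - 1) * (1 - t ^ 2))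
      ((d : ℝ) ^ 2 * (2 * t) + 4 * ((d : ℝ) - 1) * (-(2 * t))) t := by
    have hsq : HasDerivAt (fun t : ℝ => t ^ 2) (2 * t) t := by simpa using hasDerivAt_pow 2 t
    exact (hsq.const_mul _).add ((hsq.const_sub 1).const_mul _)
  have hne : (d : ℝ) ^ 2 * t ^ 2 + 4 * ((d : ℝ) - 1) * (1 - t ^ 2) ≠ 0 :=
    (Real.sqrt_pos.mp hpos).ne'
  refine (hrad.sqrt hne).congr_deriv ?_
  change _ / (2 * psiFun d t) = _
  field_simp
  ring

lemma xFun_pos {d : ℕ} (hd : 3 ≤ d) {t : ℝ} (ht0 : 0 ≤ t) (ht1 : t < 1) : 0 < xFun d t := by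
  have hD : (3 : ℝ) ≤ d := by exact_mod_cast hd
  have hd2 : 0 < ((d : ℝ) - 2) ^ 2 := by nlinarith
  exact mul_pos (div_pos (by linarith) hd2) (sub_pos.mpr (psiFun_lt hd ht0 ht1))

/-- `x(t)` solves `(1 - x/r)(1 - x/s) = t²`. -/
lemma quadratic_xFun {d : ℕ} (hd : 3 ≤ d) (t : ℝ) :
    1 - xFun d t + ((d : ℝ) - 2) ^ 2 / (4 * (d : ℝ) ^ 2) * xFun d t ^ 2 = t ^ 2 := by
  have hD : (3 : ℝ) ≤ d := by exact_mod_cast hd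
  have hd2 : (d : ℝ) - 2 ≠ 0 := by linarith
  have hd0 : (d : ℝ) ≠ 0 := by linarith
  rw [xFun]
  field_simp
  linear_combination 4 * psiFun_sq hd t

lemma mul_rConst_sConst {d : ℕ} (hd : 3 ≤ d) (x : ℝ) :
    (1 - x / rConst d) * (1 - x / sConst d)
      = 1 - x + ((d : ℝ) - 2) ^ 2 / (4 * (d : ℝ) ^ 2) * x ^ 2 := by
  have hD : (3 : ℝ) ≤ d := by exact_mod_cast hd
  have hd0 : (d : ℝ) ≠ 0 := by linarith
  have hq : √((d : ℝ) - 1) ^ 2 = d - 1 := Real.sq_sqrt (by linarith)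
  rw [rConst, sConst, div_inv_eq_mul, div_inv_eq_mul]
  field_simp
  linear_combination (-16 * x ^ 2) * hq

lemma Ffun_xFun {d : ℕ} (hd : 3 ≤ d) {t : ℝ} (ht0 : 0 ≤ t) :
    Ffun d (xFun d t)
      = (d : ℝ) / (((d : ℝ) - 1) * xFun d t) * (1 - xFun d t / 2 - t) := by
  rw [Ffun, mul_rConst_sConst hd, quadratic_xFun hd, Real.sqrt_sq ht0]

lemma xFun_lt_two {d : ℕ} (hd : 3 ≤ d) (t : ℝ) : xFun d t < 2 := by
  have hD : (3 : ℝ) ≤ d := by exact_mod_cast hd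
  have hd2 : 0 < ((d : ℝ) - 2) ^ 2 := by nlinarith
  rw [xFun, div_mul_eq_mul_div, div_lt_iff₀ hd2]
  have hsq : 4 * ((d : ℝ) - 1) ≤ psiFun d t ^ 2 := by
    nlinarith [psiFun_sq hd t, mul_nonneg hd2.le (sq_nonneg t)]
  have hlt : 4 * ((d : ℝ) - 1) < d * psiFun d t := by
    refine lt_of_pow_lt_pow_left₀ 2 (mul_nonneg (by linarith) (psiFun_pos hd t).le) ?_
    have : (d : ℝ) ^ 2 * (4 * (d - 1)) ≤ d ^ 2 * psiFun d t ^ 2 := by gcongr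
    nlinarith [mul_pos (show (0 : ℝ) < d - 1 by linarith) hd2]
  nlinarith

lemma one_sub_xFun_half_sub_pos {d : ℕ} (hd : 3 ≤ d) {t : ℝ} (ht0 : 0 ≤ t) (ht1 : t < 1) :
    0 < 1 - xFun d t / 2 - t := by
  have hD : (3 : ℝ) ≤ d := by exact_mod_cast hd
  have hd0 : (0 : ℝ) < d := by linarith
  have hx := xFun_pos hd ht0 ht1
  have hx2 := xFun_lt_two hd t
  have hk : ((d : ℝ) - 2) ^ 2 / (4 * (d : ℝ) ^ 2) < 1 / 4 := by
    rw [div_lt_iff₀ (by positivity)]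
    nlinarith
  have hlt : t < 1 - xFun d t / 2 := by
    refine lt_of_pow_lt_pow_left₀ 2 (by linarith) ?_
    nlinarith [quadratic_xFun hd t, mul_lt_mul_of_pos_right hk (pow_pos hx 2)]
  linarith

lemma hasDerivAt_xFun {d : ℕ} {t ψ' : ℝ} (hψ : HasDerivAt (psiFun d) ψ' t) :
    HasDerivAt (xFun d) (-(2 * (d : ℝ) / ((d : ℝ) - 2) ^ 2) * ψ') t :=
  ((hψ.const_sub (d : ℝ)).const_mul _).congr_deriv (by ring)

lemma hasDerivAt_log_Ffun_xFun {d : ℕ} (hd : 3 ≤ d) {t ψ' : ℝ} (ht0 : 0 < t) (ht1 : t < 1)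
    (hψ : HasDerivAt (psiFun d) ψ' t) :
    HasDerivAt (fun s => Real.log (Ffun d (xFun d s)))
      (-(2 * (d : ℝ) / ((d : ℝ) - 2) ^ 2) * ψ' / (t * xFun d t)) t := by
  have hD : (3 : ℝ) ≤ d := by exact_mod_cast hd
  have hd0 : (d : ℝ) ≠ 0 := by linarith
  have hd1 : (d : ℝ) - 1 ≠ 0 := by linarith
  have hx' := hasDerivAt_xFun hψ
  set y := -(2 * (d : ℝ) / ((d : ℝ) - 2) ^ 2) * ψ' with hy
  have hx := xFun_pos hd ht0.le ht1
  have hu := one_sub_xFun_half_sub_pos hd ht0.le ht1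
  have hrel : 2 * t = y * (((d : ℝ) - 2) ^ 2 / (2 * (d : ℝ) ^ 2) * xFun d t - 1) := by
    have hleft : HasDerivAt
        (fun s => 1 - xFun d s + ((d : ℝ) - 2) ^ 2 / (4 * (d : ℝ) ^ 2) * xFun d s ^ 2)
        (-y + ((d : ℝ) - 2) ^ 2 / (4 * (d : ℝ) ^ 2) * (2 * xFun d t * y)) t := by
      refine ((hx'.const_sub 1).add ((hx'.pow 2).const_mul _)).congr_deriv ?_
      simp
    have hright : HasDerivAt (fun s : ℝ => s ^ 2) (2 * t) t := by simpa using hasDerivAt_pow 2 t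
    rw [funext (quadratic_xFun hd)] at hleft
    rw [hright.unique hleft]
    field_simp
    ring
  have heq : (fun s => Real.log (Ffun d (xFun d s))) =ᶠ[𝓝 t] fun s =>
      Real.log ((d : ℝ) / (d - 1)) - Real.log (xFun d s)
        + Real.log (1 - xFun d s / 2 - s) := by
    filter_upwards [Ioo_mem_nhds ht0 ht1] with s hs
    have hxs := xFun_pos hd hs.1.le hs.2
    have hus := one_sub_xFun_half_sub_pos hd hs.1.le hs.2
    rw [Ffun_xFun hd hs.1.le, ← div_div, Real.log_mul (by positivity) hus.ne',
      Real.log_div (by positivity) hxs.ne']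
  have hder : HasDerivAt (fun s => Real.log ((d : ℝ) / (d - 1)) - Real.log (xFun d s)
        + Real.log (1 - xFun d s / 2 - s))
      (-(y / xFun d t) + (-(y / 2) - 1) / (1 - xFun d t / 2 - t)) t :=
    ((hx'.log hx.ne').const_sub _).add
      ((((hx'.div_const 2).const_sub 1).sub (hasDerivAt_id t)).log hu.ne')
  refine (hder.congr_of_eventuallyEq heq).congr_deriv ?_
  have hu0 := hu.ne'
  have hquad := quadratic_xFun hd t
  have htx : t * xFun d t = y * (t ^ 2 - 1 + xFun d t / 2) := by
    rw [← hquad]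
    linear_combination (xFun d t / 2) * hrel
  generalize xFun d t = x at *
  have hx0 := hx.ne'
  have ht := ht0.ne'
  have key : -(y / x) + (-(y / 2) - 1) / (1 - x / 2 - t) - y / (t * x)
      = -(y * (1 - x / 2 - t) * (1 + t) + y * t * x / 2 + t * x) / (t * x * (1 - x / 2 - t)) := by
    generalize hv : 1 - x / 2 - t = v at *
    field_simp
    ring
  rw [← sub_eq_zero, key, htx]
  ring

lemma tendsto_log_Ffun_xFun {d : ℕ} (hd : 3 ≤ d) :
    Tendsto (fun t => Real.log (Ffun d (xFun d t))) (𝓝[>] 0)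
      (𝓝 (-((1 / 2) * Real.log ((d : ℝ) - 1)))) := by
  have hD : (3 : ℝ) ≤ d := by exact_mod_cast hd
  have hd1 : 0 < (d : ℝ) - 1 := by linarith
  have hd2 : (d : ℝ) - 2 ≠ 0 := by linarith
  have hx := xFun_pos hd le_rfl one_pos
  have hcx : ContinuousAt (xFun d) 0 := (hasDerivAt_xFun (hasDerivAt_psiFun hd 0)).continuousAt
  have hval : (d : ℝ) / ((d - 1) * xFun d 0) * (1 - xFun d 0 / 2 - 0) = (√((d : ℝ) - 1))⁻¹ := by
    have hq : √((d : ℝ) - 1) ^ 2 = d - 1 := Real.sq_sqrt hd1.le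
    have hq0 : 0 < √((d : ℝ) - 1) := Real.sqrt_pos.mpr hd1
    have hψ : psiFun d 0 = 2 * √((d : ℝ) - 1) := by
      refine (pow_left_inj₀ (psiFun_pos hd 0).le (by positivity) two_ne_zero).mp ?_
      rw [psiFun_sq hd, mul_pow, hq]
      ring
    have hxq : xFun d 0 * (√((d : ℝ) - 1) + 1) ^ 2 = 2 * d := by
      rw [xFun, hψ]
      field_simp
      generalize √((d : ℝ) - 1) = q at *
      rw [show (d : ℝ) = q ^ 2 + 1 by linarith]
      ring
    generalize √((d : ℝ) - 1) = q at *
    have hdq : (d : ℝ) = q ^ 2 + 1 := by linarith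
    have hxe : xFun d 0 = 2 * d / (q + 1) ^ 2 := by
      rw [eq_div_iff (by positivity), hxq]
    rw [hxe, hdq]
    have hdq1 : q ^ 2 + 1 - 1 ≠ 0 := by rw [add_sub_cancel_right]; positivity
    field_simp
    ring
  have hlim : ContinuousAt
      (fun t => Real.log ((d : ℝ) / ((d - 1) * xFun d t) * (1 - xFun d t / 2 - t))) 0 := by
    refine ContinuousAt.log ?_ (by rw [hval]; exact (inv_pos.mpr (Real.sqrt_pos.mpr hd1)).ne')
    exact (continuousAt_const.div (continuousAt_const.mul hcx) (mul_pos hd1 hx).ne').mul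
      ((continuousAt_const.sub (hcx.div_const 2)).sub continuousAt_id)
  have hlog : Real.log ((d : ℝ) / ((d - 1) * xFun d 0) * (1 - xFun d 0 / 2 - 0))
      = -((1 / 2) * Real.log ((d : ℝ) - 1)) := by
    rw [hval, Real.log_inv, Real.log_sqrt hd1.le]
    ring
  rw [← hlog]
  refine (hlim.tendsto.mono_left nhdsWithin_le_nhds).congr' ?_
  filter_upwards [self_mem_nhdsWithin] with t ht
  rw [Ffun_xFun hd (le_of_lt ht)]

/-- **Lemma.** Assume that for every `t ∈ (0,1)` the infimum defining `φ(t)` is attained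
at `x(t)`. Then `φ` is twice differentiable on `(0,1)` with `φ'(t) = log F(x(t))` and
`φ''(t) = -(2d/(d-2)²)·ψ'(t)/(t·x(t)) < 0`; in particular
`lim_{t → 0⁺} φ'(t) = -(1/2)·log(d-1)`. -/
theorem phi_twice_differentiable (d : ℕ) (hd : 3 ≤ d)
    (hmin : ∀ t ∈ Set.Ioo (0 : ℝ) 1,
      phiFun d t = t * Real.log (Ffun d (xFun d t)) - Real.log (xFun d t)) :
    (∀ t ∈ Set.Ioo (0 : ℝ) 1,
      HasDerivAt (phiFun d) (Real.log (Ffun d (xFun d t))) t) ∧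
    (∀ t ∈ Set.Ioo (0 : ℝ) 1, ∀ ψ' : ℝ, HasDerivAt (psiFun d) ψ' t →
      HasDerivAt (fun s => Real.log (Ffun d (xFun d s)))
          (-(2 * (d : ℝ) / ((d : ℝ) - 2) ^ 2) * ψ' / (t * xFun d t)) t ∧
        -(2 * (d : ℝ) / ((d : ℝ) - 2) ^ 2) * ψ' / (t * xFun d t) < 0) ∧
    Tendsto (fun t => Real.log (Ffun d (xFun d t))) (nhdsWithin 0 (Set.Ioi 0))
      (nhds (-((1 / 2) * Real.log ((d : ℝ) - 1)))) := by
  have hD : (3 : ℝ) ≤ d := by exact_mod_cast hd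
  refine ⟨fun t ht => ?_, fun t ht ψ' hψ => ⟨hasDerivAt_log_Ffun_xFun hd ht.1 ht.2 hψ, ?_⟩,
    tendsto_log_Ffun_xFun hd⟩
  · have hψ := hasDerivAt_psiFun hd t
    have hx := (xFun_pos hd ht.1.le ht.2).ne'
    have ht0 := ht.1.ne'
    have heq : phiFun d =ᶠ[𝓝 t]
        fun s => s * Real.log (Ffun d (xFun d s)) - Real.log (xFun d s) := by
      filter_upwards [Ioo_mem_nhds ht.1 ht.2] with s hs using hmin s hs
    have hder := ((hasDerivAt_id t).mul (hasDerivAt_log_Ffun_xFun hd ht.1 ht.2 hψ)).sub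
      ((hasDerivAt_xFun hψ).log hx)
    refine (hder.congr_of_eventuallyEq heq).congr_deriv ?_
    rw [id_eq]
    field_simp
    ring
  · have hx := xFun_pos hd ht.1.le ht.2
    have hψp := psiFun_pos hd t
    have ht0 := ht.1
    have hd2 : 0 < (d : ℝ) - 2 := by linarith
    rw [hψ.unique (hasDerivAt_psiFun hd t), neg_mul, neg_div]
    exact neg_neg_of_pos (by positivity)

end GrowthURT
end
end
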